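/- Fix n, m ≥ 1 with n ≥ m + 1 and A = {a_1,…,a_n}. For each ℓ, let G = ⟨A ∣ R⟩_M where R consists of m independent random relators of length ℓ. Then asymptotically almost surely as ℓ → ∞, in any decomposition of G as a direct product G = G_1 × ⋯ × G_k, all but at most one of the factors G_1,…,G_k are virtually abelian. -/

import Mathlib

instance derivedSeriesNormal {G : Type*} [Group G] (k : ℕ) : (derivedSeries G k).Normal :=
  derivedSeries_normal G k

/-- The normal subgroup `N · F''` of the free group determined by the relators `R`,
where `N` is the normal closure of `R` and `F''` is the second derived subgroup. -/
def metabelianRel {n : ℕ} (R : Set (FreeGroup (Fin n))) : Subgroup (FreeGroup (Fin n)) :=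
  Subgroup.normalClosure (R ∪ (derivedSeries (FreeGroup (Fin n)) 2 : Subgroup (FreeGroup (Fin n))))

instance {n : ℕ} (R : Set (FreeGroup (Fin n))) : (metabelianRel R).Normal :=
  Subgroup.normalClosure_normal

/-- The metabelian group presented by `⟨A ∣ R⟩_M`, i.e. `F(A)/(N·F(A)'')`. -/
abbrev MetabelianPresented {n : ℕ} (R : Set (FreeGroup (Fin n))) : Type :=
  FreeGroup (Fin n) ⧸ metabelianRel R

/-- A group is virtually abelian if it has an abelian subgroup of finite index. -/
def VirtuallyAbelian (G : Type*) [Group G] : Prop :=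
  ∃ H : Subgroup G, (∀ x ∈ H, ∀ y ∈ H, x * y = y * x) ∧ H.FiniteIndex

/-- The metabelian group presented by the `m` relators of length `ℓ` encoded by `w`:
each letter of a word is a generator index in `Fin n` together with a sign (`true` for the
generator, `false` for its inverse), and the word is read off as an element of the free
group by concatenating its letters. -/
abbrev RandomMetabelian {n m ℓ : ℕ} (w : Fin m → Fin ℓ → Fin n × Bool) : Type :=
  MetabelianPresented (Set.range fun i => FreeGroup.mk (List.ofFn (w i)))

open scoped commutatorElement

/-- An infinite finitely generated abelian group maps nontrivially to the integers. -/
lemma exists_hom_int (Q : Type) [CommGroup Q] [Group.FG Q] (hQ : ¬ Finite Q) :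
    ∃ f : Q →* Multiplicative ℤ, ∃ g, f g ≠ 1 := by
  obtain ⟨r, ι, _, p, hp, e, ⟨φ⟩⟩ :=
    AddCommGroup.equiv_free_prod_directSum_zmod (Additive Q)
  rcases Nat.eq_zero_or_pos r with hr | hr
  · exfalso
    subst hr
    have : ∀ i, NeZero (p i ^ e i) := fun i => ⟨pow_ne_zero _ (hp i).ne_zero⟩
    classical
    have : Finite (DirectSum ι fun i => ZMod (p i ^ e i)) :=
      Finite.of_equiv _ (DirectSum.addEquivProd (fun i => ZMod (p i ^ e i))).symm.toEquiv
    exact hQ (Finite.of_equiv _ (φ.symm.toEquiv.trans Additive.toMul))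
  · let ψ : Additive Q →+ ℤ :=
      (Finsupp.applyAddHom (⟨0, hr⟩ : Fin r)).comp
        ((AddMonoidHom.fst _ _).comp φ.toAddMonoidHom)
    refine ⟨AddMonoidHom.toMultiplicativeRight ψ, (φ.symm (Finsupp.single ⟨0, hr⟩ 1, 0)).toMul, ?_⟩
    intro h
    have h2 : ψ (φ.symm (Finsupp.single ⟨0, hr⟩ 1, 0)) = 0 := h
    simp [ψ] at h2

/-- A finitely generated metabelian group that is not virtually abelian maps onto an infinite
cyclic group. -/
lemma exists_hom_int_of_not_va (H : Type) [Group H] [Group.FG H]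
    (hd : derivedSeries H 2 = ⊥) (hv : ¬ VirtuallyAbelian H) :
    ∃ f : H →* Multiplicative ℤ, ∃ g, f g ≠ 1 := by
  have hinf : ¬ Finite (Abelianization H) := by
    intro hfin
    apply hv
    refine ⟨commutator H, ?_, ?_⟩
    · intro x hx y hy
      have h1 : ⁅x, y⁆ ∈ derivedSeries H 2 := by
        have : derivedSeries H 2 = ⁅derivedSeries H 1, derivedSeries H 1⁆ := rfl
        rw [this, derivedSeries_one]
        exact Subgroup.commutator_mem_commutator hx hy
      rw [hd, Subgroup.mem_bot] at h1
      exact commutatorElement_eq_one_iff_mul_comm.1 h1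
    · have : Finite (H ⧸ commutator H) := hfin
      exact Subgroup.finiteIndex_of_finite_quotient
  have : Group.FG (Abelianization H) :=
    Group.fg_of_surjective (f := Abelianization.of) (QuotientGroup.mk'_surjective _)
  obtain ⟨f, g, hg⟩ := exists_hom_int _ hinf
  obtain ⟨g, rfl⟩ := QuotientGroup.mk'_surjective _ g
  exact ⟨f.comp Abelianization.of, g, hg⟩

/-- Elements of the presented quotient: second derived subgroup is killed. -/
lemma derived_two_le {n : ℕ} (R : Set (FreeGroup (Fin n))) :
    derivedSeries (FreeGroup (Fin n)) 2 ≤ metabelianRel R :=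
  fun _ hx => Subgroup.subset_normalClosure (Or.inr hx)

lemma derived_two_quot {n : ℕ} {R : Set (FreeGroup (Fin n))} {H : Type} [Group H]
    (π : MetabelianPresented R →* H) (hπ : Function.Surjective π) :
    derivedSeries H 2 = ⊥ := by
  let φ : FreeGroup (Fin n) →* H := π.comp (QuotientGroup.mk' (metabelianRel R))
  have hφ : Function.Surjective φ := hπ.comp (QuotientGroup.mk'_surjective _)
  rw [← map_derivedSeries_eq hφ 2, eq_bot_iff]
  rintro _ ⟨x, hx, rfl⟩
  have : QuotientGroup.mk' (metabelianRel R) x = 1 :=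
    (QuotientGroup.eq_one_iff x).2 (derived_two_le R hx)
  simp [φ, MonoidHom.comp_apply, this]

lemma permAux {α : Type*} (f : Equiv.Perm α) (x : α) : f (f⁻¹ x) = x :=
  Equiv.apply_symm_apply f x

section Affine
variable {n : ℕ} {V : Type*} [AddCommGroup V] [Module ℚ V]

/-- The affine action of the free group with linear part `χ` and translation parts `d`. -/
noncomputable def affRep (χ : FreeGroup (Fin n) →* ℚˣ) (d : Fin n → V) :
    FreeGroup (Fin n) →* Equiv.Perm V :=
  FreeGroup.lift fun s => Equiv.addLeft (d s) * MulAction.toPerm (χ (FreeGroup.of s))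

lemma affRep_of (χ : FreeGroup (Fin n) →* ℚˣ) (d : Fin n → V) (s : Fin n) (z : V) :
    affRep χ d (FreeGroup.of s) z = d s + χ (FreeGroup.of s) • z := by
  simp [affRep]

lemma affRep_sub (χ : FreeGroup (Fin n) →* ℚˣ) (d : Fin n → V) (w : FreeGroup (Fin n)) :
    ∀ z z' : V, affRep χ d w z - affRep χ d w z' = χ w • (z - z') := by
  induction w using FreeGroup.induction_on with
  | C1 => simp
  | of s => intro z z'; simp [affRep_of, smul_sub]
  | inv_of s h =>
    intro z z'
    have := h (affRep χ d (FreeGroup.of s)⁻¹ z) (affRep χ d (FreeGroup.of s)⁻¹ z')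
    rw [map_inv, permAux, permAux] at this
    rw [map_inv, map_inv, this, inv_smul_smul]
  | mul x y hx hy =>
    intro z z'
    simp only [map_mul, Equiv.Perm.mul_apply]
    rw [hx, hy, mul_smul]

lemma affRep_derived (χ : FreeGroup (Fin n) →* ℚˣ) (d : Fin n → V) (w : FreeGroup (Fin n))
    (hw : w ∈ derivedSeries (FreeGroup (Fin n)) 2) : affRep χ d w = 1 := by
  have h1 : ∀ x ∈ derivedSeries (FreeGroup (Fin n)) 1, χ x = 1 := by
    intro x hx
    rw [derivedSeries_one] at hx
    exact Abelianization.commutator_subset_ker χ hx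
  have h2 : ∀ x ∈ derivedSeries (FreeGroup (Fin n)) 1, ∀ z,
      affRep χ d x z = z + affRep χ d x 0 := by
    intro x hx z
    have := affRep_sub χ d x z 0
    rw [h1 x hx] at this
    simp at this
    exact sub_eq_iff_eq_add.1 this
  have h3 : derivedSeries (FreeGroup (Fin n)) 2 ≤ (affRep χ d).ker := by
    change ⁅derivedSeries (FreeGroup (Fin n)) 1, derivedSeries (FreeGroup (Fin n)) 1⁆ ≤ _
    rw [Subgroup.commutator_le]
    intro x hx y hy
    rw [MonoidHom.mem_ker, map_commutatorElement, commutatorElement_eq_one_iff_mul_comm]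
    ext z
    simp only [Equiv.Perm.mul_apply]
    rw [h2 x hx, h2 y hy, h2 y hy (affRep χ d x z), h2 x hx z]
    abel
  exact h3 hw

lemma affRep_map {W : Type*} [AddCommGroup W] [Module ℚ W] (q : V →ₗ[ℚ] W)
    (χ : FreeGroup (Fin n) →* ℚˣ) (d : Fin n → V) (w : FreeGroup (Fin n)) :
    ∀ z, affRep χ (fun s => q (d s)) w (q z) = q (affRep χ d w z) := by
  induction w using FreeGroup.induction_on with
  | C1 => simp
  | of s => intro z; simp [affRep_of, Units.smul_def]
  | inv_of s h =>
    intro z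
    rw [map_inv, Equiv.Perm.inv_eq_iff_eq, h, map_inv, permAux]
  | mul x y hx hy => intro z; simp only [map_mul, Equiv.Perm.mul_apply]; rw [hy, hx]

end Affine

/-- The affine representation argument: with at least two more generators than relators, there
are no two commuting elements `g₁, g₂` with nontrivial multiplier such that every element is a
product of one commuting with `g₁` and one commuting with `g₂`. -/
lemma no_commuting {n m : ℕ} (hnm : m + 2 ≤ n) (r : Fin m → FreeGroup (Fin n))
    (χ : MetabelianPresented (Set.range r) →* ℚˣ)
    (g₁ g₂ : MetabelianPresented (Set.range r)) (h12 : Commute g₁ g₂)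
    (h1 : χ g₁ ≠ 1) (h2 : χ g₂ ≠ 1)
    (hall : ∀ g, ∃ x y, g = x * y ∧ Commute x g₁ ∧ Commute y g₂) : False := by
  let μ := QuotientGroup.mk' (metabelianRel (Set.range r))
  let χ' : FreeGroup (Fin n) →* ℚˣ := χ.comp μ
  have hrμ : ∀ i, μ (r i) = 1 := fun i =>
    (QuotientGroup.eq_one_iff _).2 (Subgroup.subset_normalClosure (Or.inl ⟨i, rfl⟩))
  let d : Fin n → (Fin n → ℚ) := fun s => Pi.single s 1
  let N : Submodule ℚ (Fin n → ℚ) :=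
    Submodule.span ℚ (Set.range fun i => affRep χ' d (r i) 0)
  let q := N.mkQ
  let ρ := affRep χ' (fun s => q (d s))
  have hker : metabelianRel (Set.range r) ≤ ρ.ker := by
    refine Subgroup.normalClosure_le_normal ?_
    rintro x (⟨i, rfl⟩ | hx)
    · have h0 : ρ (r i) 0 = 0 := by
        have := affRep_map q χ' d (r i) 0
        rw [map_zero] at this
        simp only [ρ, this]
        exact (Submodule.Quotient.mk_eq_zero N).2 (Submodule.subset_span ⟨i, rfl⟩)
      change ρ (r i) = 1
      ext z
      have := affRep_sub χ' (fun s => q (d s)) (r i) z 0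
      change ρ (r i) z - ρ (r i) 0 = _ at this
      rw [h0] at this
      simpa [χ', hrμ] using this
    · exact affRep_derived _ _ _ hx
  let σ : MetabelianPresented (Set.range r) →* Equiv.Perm ((Fin n → ℚ) ⧸ N) :=
    QuotientGroup.lift _ ρ hker
  have hσ : ∀ g z z', σ g z - σ g z' = χ g • (z - z') := by
    intro g z z'
    obtain ⟨g, rfl⟩ := QuotientGroup.mk'_surjective _ g
    exact affRep_sub χ' (fun s => q (d s)) g z z'
  have huniq : ∀ g, χ g ≠ 1 → ∀ z z', σ g z = z → σ g z' = z' → z = z' := by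
    intro g hg z z' hz hz'
    have := hσ g z z'
    rw [hz, hz', Units.smul_def] at this
    have h3 : ((χ g : ℚ) - 1) • (z - z') = 0 := by rw [sub_smul, ← this, one_smul, sub_self]
    rcases smul_eq_zero.1 h3 with h | h
    · exact absurd (Units.ext (by simpa using sub_eq_zero.1 h)) hg
    · exact sub_eq_zero.1 h
  have hcomm : ∀ g x, Commute x g → χ g ≠ 1 → ∀ z, σ g z = z → σ x z = z := by
    intro g x hx hg z hz
    refine huniq g hg _ _ ?_ hz
    rw [← Equiv.Perm.mul_apply, ← map_mul, ← hx.eq, map_mul, Equiv.Perm.mul_apply, hz]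
  obtain ⟨p, hp⟩ : ∃ p, σ g₁ p = p := by
    have hne : (1 - (χ g₁ : ℚ)) ≠ 0 := by
      intro h
      exact h1 (Units.ext (by simpa using (sub_eq_zero.1 h).symm))
    refine ⟨(1 - (χ g₁ : ℚ))⁻¹ • σ g₁ 0, ?_⟩
    have := hσ g₁ ((1 - (χ g₁ : ℚ))⁻¹ • σ g₁ 0) 0
    rw [sub_eq_iff_eq_add] at this
    rw [this, sub_zero, Units.smul_def, smul_smul]
    nth_rw 2 [← one_smul ℚ (σ g₁ 0)]
    rw [← add_smul]
    congr 1
    field_simp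
    ring
  have hp2 : σ g₂ p = p := hcomm g₁ g₂ h12.symm h1 p hp
  have hfix : ∀ g, σ g p = p := by
    intro g
    obtain ⟨x, y, rfl, hx, hy⟩ := hall g
    rw [map_mul, Equiv.Perm.mul_apply, hcomm g₂ y hy h2 p hp2, hcomm g₁ x hx h1 p hp]
  have hspan : ∀ s, q (d s) ∈ Submodule.span ℚ {p} := by
    intro s
    have : ρ (FreeGroup.of s) p = p := hfix (μ (FreeGroup.of s))
    simp only [ρ] at this
    rw [affRep_of, Units.smul_def] at this
    have h5 : q (d s) = (1 - (χ' (FreeGroup.of s) : ℚ)) • p := by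
      rw [sub_smul, one_smul]; exact eq_sub_of_add_eq this
    rw [h5]
    exact Submodule.smul_mem _ _ (Submodule.mem_span_singleton_self p)
  have htop : (⊤ : Submodule ℚ ((Fin n → ℚ) ⧸ N)) ≤ Submodule.span ℚ {p} := by
    rintro z -
    obtain ⟨z, rfl⟩ := N.mkQ_surjective z
    rw [pi_eq_sum_univ' z, map_sum]
    refine Submodule.sum_mem _ fun s _ => ?_
    rw [map_smul]
    refine Submodule.smul_mem _ _ ?_
    convert hspan s using 2
  have hf1 : Module.finrank ℚ ((Fin n → ℚ) ⧸ N) ≤ 1 := by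
    rw [← finrank_top]
    exact (Submodule.finrank_mono htop).trans
      ((finrank_span_le_card ({p} : Set _)).trans (by simp))
  have hf2 : Module.finrank ℚ N ≤ m := by
    refine (finrank_range_le_card _).trans (by simp)
  have := Submodule.finrank_quotient_add_finrank N
  rw [Module.finrank_fin_fun] at this
  omega

/-- Existence of the two elements and homomorphisms in a bad decomposition. -/
lemma exists_pair {n : ℕ} (R : Set (FreeGroup (Fin n))) (k : ℕ) (Gi : Fin k → Type)
    [∀ i, Group (Gi i)] (e : MetabelianPresented R ≃* ∀ i, Gi i) (i : Fin k)
    (hi : ¬ VirtuallyAbelian (Gi i)) :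
    ∃ f : Gi i →* Multiplicative ℤ, ∃ g, f g ≠ 1 := by
  let π : MetabelianPresented R →* Gi i := (Pi.evalMonoidHom Gi i).comp e.toMonoidHom
  have hπ : Function.Surjective π := by
    intro x
    refine ⟨e.symm (Pi.mulSingle i x), ?_⟩
    simp [π]
  have : Group.FG (MetabelianPresented R) :=
    Group.fg_of_surjective (f := QuotientGroup.mk' (metabelianRel R))
      (QuotientGroup.mk'_surjective _)
  have : Group.FG (Gi i) := Group.fg_of_surjective hπ
  exact exists_hom_int_of_not_va _ (derived_two_quot π hπ) hi

lemma core_one {n m : ℕ} (hnm : m + 2 ≤ n) (r : Fin m → FreeGroup (Fin n))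
    (k : ℕ) (Gi : Fin k → Type) [∀ i, Group (Gi i)]
    (e : MetabelianPresented (Set.range r) ≃* ∀ i, Gi i) (i j : Fin k) (hij : i ≠ j) :
    VirtuallyAbelian (Gi i) ∨ VirtuallyAbelian (Gi j) := by
  by_contra! hcon
  obtain ⟨f₁, g₁, h1⟩ := exists_pair _ k Gi e i hcon.1
  obtain ⟨f₂, g₂, h2⟩ := exists_pair _ k Gi e j hcon.2
  let u : ℚˣ := Units.mk0 2 (by norm_num)
  have hu : ∀ t : Multiplicative ℤ, t ≠ 1 → zpowersHom ℚˣ u t ≠ 1 := by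
    intro t ht h
    rw [zpowersHom_apply, Units.ext_iff] at h
    simp only [Units.val_zpow_eq_zpow_val, u, Units.val_mk0, Units.val_one] at h
    have := zpow_right_injective₀ (a := (2 : ℚ)) (by norm_num) (by norm_num)
      (h.trans (zpow_zero 2).symm)
    exact ht this
  let χ : MetabelianPresented (Set.range r) →* ℚˣ :=
    (zpowersHom ℚˣ u).comp
      ((f₁.comp (Pi.evalMonoidHom Gi i) * f₂.comp (Pi.evalMonoidHom Gi j)).comp e.toMonoidHom)
  have hc : ∀ x y : MetabelianPresented (Set.range r), Commute (e x) (e y) → Commute x y := by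
    intro x y h
    apply e.injective
    rw [map_mul, map_mul]; exact h
  refine no_commuting hnm r χ (e.symm (Pi.mulSingle i g₁)) (e.symm (Pi.mulSingle j g₂))
    ?_ ?_ ?_ ?_
  · apply hc
    simp only [MulEquiv.apply_symm_apply]
    exact Pi.mulSingle_commute hij _ _
  · have : χ (e.symm (Pi.mulSingle i g₁)) = zpowersHom ℚˣ u (f₁ g₁) := by
      simp [χ, Pi.mulSingle_eq_of_ne hij.symm]
    rw [this]; exact hu _ h1
  · have : χ (e.symm (Pi.mulSingle j g₂)) = zpowersHom ℚˣ u (f₂ g₂) := by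
      simp [χ, Pi.mulSingle_eq_of_ne hij]
    rw [this]; exact hu _ h2
  · intro g
    refine ⟨e.symm (Function.update (e g) i 1), e.symm (Pi.mulSingle i (e g i)), ?_, ?_, ?_⟩
    · rw [← map_mul, eq_comm, MulEquiv.symm_apply_eq]
      ext t
      by_cases ht : t = i
      · subst ht; simp
      · simp [ht]
    · apply hc
      simp only [MulEquiv.apply_symm_apply]
      change _ = _
      ext t
      by_cases ht : t = i
      · subst ht; simp
      · simp [ht]
    · apply hc
      simp only [MulEquiv.apply_symm_apply]
      exact Pi.mulSingle_commute hij _ _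

/-- The sign of a letter. -/
def letterSign (b : Bool) : ℤ := if b then 1 else -1

/-- The image of a word in the abelianization `ℤ^n`. -/
def wordVec {n ℓ : ℕ} (w : Fin ℓ → Fin n × Bool) (s : Fin n) : ℤ :=
  ∑ k, if (w k).1 = s then letterSign (w k).2 else 0

/-- The abelianized relators are linearly dependent modulo `p`. -/
def BadMod (p : ℕ) {n m ℓ : ℕ} (w : Fin m → Fin ℓ → Fin n × Bool) : Prop :=
  ∃ c : Fin m → ZMod p, c ≠ 0 ∧ ∀ s, ∑ i, c i * (wordVec (w i) s : ZMod p) = 0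

lemma sum_wordVec {n ℓ : ℕ} {A : Type*} [CommRing A] (w : Fin ℓ → Fin n × Bool) (u : Fin n → A) :
    ∑ s, (wordVec w s : A) * u s = ∑ k, (letterSign (w k).2 : A) * u (w k).1 := by
  simp only [wordVec, Int.cast_sum, Finset.sum_mul]
  rw [Finset.sum_comm]
  refine Finset.sum_congr rfl fun k _ => ?_
  simp [apply_ite (Int.cast : ℤ → A), ite_mul]

lemma hom_word {n ℓ : ℕ} (f : FreeGroup (Fin n) →* Multiplicative ℤ)
    (w : Fin ℓ → Fin n × Bool) :
    (f (FreeGroup.mk (List.ofFn w))).toAdd =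
      ∑ s, wordVec w s * (f (FreeGroup.of s)).toAdd := by
  have h0 := sum_wordVec (A := ℤ) w (fun s => (f (FreeGroup.of s)).toAdd)
  simp only [Int.cast_id] at h0
  rw [h0]
  have h1 : f = FreeGroup.lift (fun s => f (FreeGroup.of s)) := by
    ext s; simp
  conv_lhs => rw [h1]
  rw [FreeGroup.lift_mk, List.map_ofFn, List.prod_ofFn, toAdd_prod]
  refine Finset.sum_congr rfl fun k _ => ?_
  rcases h : w k with ⟨s, b⟩
  cases b <;> simp [letterSign, h]

lemma linInd_of_not_bad {p n m ℓ : ℕ} (hp : p.Prime) {w : Fin m → Fin ℓ → Fin n × Bool}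
    (hw : ¬ BadMod p w) : LinearIndependent ℤ (fun i => wordVec (w i)) := by
  rw [Fintype.linearIndependent_iff]
  intro c hc
  by_contra! hne
  apply hw
  obtain ⟨i₀, hi₀⟩ := hne
  obtain ⟨g, hg, hgcd⟩ := Finset.extract_gcd (s := Finset.univ) c ⟨i₀, Finset.mem_univ _⟩
  have hd : Finset.univ.gcd c ≠ 0 := by
    intro h
    apply hi₀
    rw [hg i₀ (Finset.mem_univ _), h, zero_mul]
  have hgs : ∀ s, ∑ i, g i * wordVec (w i) s = 0 := by
    intro s
    have h1 := congrFun hc s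
    simp only [Finset.sum_apply, Pi.smul_apply, smul_eq_mul, Pi.zero_apply] at h1
    have h2 : Finset.univ.gcd c * ∑ i, g i * wordVec (w i) s = 0 := by
      rw [← h1, Finset.mul_sum]
      refine Finset.sum_congr rfl fun i _ => ?_
      rw [hg i (Finset.mem_univ _), mul_assoc]
    exact (mul_eq_zero.1 h2).resolve_left hd
  refine ⟨fun i => (g i : ZMod p), ?_, ?_⟩
  · intro h
    have hdvd : (p : ℤ) ∣ Finset.univ.gcd g := by
      refine Finset.dvd_gcd fun i _ => ?_
      exact (ZMod.intCast_zmod_eq_zero_iff_dvd _ _).1 (congrFun h i)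
    rw [hgcd] at hdvd
    have := Int.natCast_dvd_natCast.1 (by simpa using hdvd : (p : ℤ) ∣ ((1 : ℕ) : ℤ))
    exact hp.one_lt.ne' (Nat.dvd_one.1 this)
  · intro s
    have := congrArg (Int.cast : ℤ → ZMod p) (hgs s)
    push_cast at this
    exact this

lemma orth_bound {n m : ℕ} (v : Fin m → Fin n → ℤ) (hv : LinearIndependent ℤ v)
    (u : Fin 2 → Fin n → ℤ) (hu : LinearIndependent ℤ u)
    (huv : ∀ i j, v i ⬝ᵥ u j = 0) : m + 2 ≤ n := by
  have hli : LinearIndependent ℤ (Sum.elim v u) := by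
    refine hv.sum_type hu ?_
    rw [Submodule.disjoint_def]
    intro x hx hy
    have h1 : ∀ i, ∀ y ∈ Submodule.span ℤ (Set.range u), v i ⬝ᵥ y = 0 := by
      intro i y hy
      induction hy using Submodule.span_induction with
      | mem y hy => obtain ⟨j, rfl⟩ := hy; exact huv i j
      | zero => simp
      | add a b _ _ ha hb => rw [dotProduct_add, ha, hb, add_zero]
      | smul a b _ hb => rw [dotProduct_smul, hb, smul_zero]
    have h2 : ∀ y ∈ Submodule.span ℤ (Set.range u), ∀ x ∈ Submodule.span ℤ (Set.range v),
        x ⬝ᵥ y = 0 := by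
      intro y hy x hx
      induction hx using Submodule.span_induction with
      | mem x hx => obtain ⟨i, rfl⟩ := hx; exact h1 i y hy
      | zero => simp
      | add a b _ _ ha hb => rw [add_dotProduct, ha, hb, add_zero]
      | smul a b _ hb => rw [smul_dotProduct, hb, smul_zero]
    exact dotProduct_self_eq_zero.1 (h2 x hy x hx)
  have := hli.fintype_card_le_finrank
  simpa using this

lemma core_two {p n m ℓ : ℕ} (hp : p.Prime) (hnm : n < m + 2)
    {w : Fin m → Fin ℓ → Fin n × Bool} (hw : ¬ BadMod p w)
    (k : ℕ) (Gi : Fin k → Type) [∀ i, Group (Gi i)]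
    (e : RandomMetabelian w ≃* ∀ i, Gi i) (i j : Fin k) (hij : i ≠ j) :
    VirtuallyAbelian (Gi i) ∨ VirtuallyAbelian (Gi j) := by
  by_contra! hcon
  obtain ⟨f₁, g₁, h1⟩ := exists_pair _ k Gi e i hcon.1
  obtain ⟨f₂, g₂, h2⟩ := exists_pair _ k Gi e j hcon.2
  let μ := QuotientGroup.mk' (metabelianRel (Set.range fun i => FreeGroup.mk (List.ofFn (w i))))
  let F₁ : FreeGroup (Fin n) →* Multiplicative ℤ :=
    (f₁.comp (Pi.evalMonoidHom Gi i)).comp (e.toMonoidHom.comp μ)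
  let F₂ : FreeGroup (Fin n) →* Multiplicative ℤ :=
    (f₂.comp (Pi.evalMonoidHom Gi j)).comp (e.toMonoidHom.comp μ)
  obtain ⟨x₁, hx₁⟩ := QuotientGroup.mk'_surjective _ (e.symm (Pi.mulSingle i g₁))
  obtain ⟨x₂, hx₂⟩ := QuotientGroup.mk'_surjective _ (e.symm (Pi.mulSingle j g₂))
  have a11 : F₁ x₁ ≠ 1 := by
    change f₁ (e (μ x₁) i) ≠ 1
    simp only [μ, hx₁]; simpa using h1
  have a12 : F₁ x₂ = 1 := by
    change f₁ (e (μ x₂) i) = 1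
    simp only [μ, hx₂]; simp [Pi.mulSingle_eq_of_ne hij]
  have a21 : F₂ x₁ = 1 := by
    change f₂ (e (μ x₁) j) = 1
    simp only [μ, hx₁]; simp [Pi.mulSingle_eq_of_ne hij.symm]
  have a22 : F₂ x₂ ≠ 1 := by
    change f₂ (e (μ x₂) j) ≠ 1
    simp only [μ, hx₂]; simpa using h2
  have hr : ∀ t, μ (FreeGroup.mk (List.ofFn (w t))) = 1 := fun t =>
    (QuotientGroup.eq_one_iff _).2 (Subgroup.subset_normalClosure (Or.inl ⟨t, rfl⟩))
  let F : Fin 2 → FreeGroup (Fin n) →* Multiplicative ℤ := ![F₁, F₂]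
  let u : Fin 2 → Fin n → ℤ := fun t s => (F t (FreeGroup.of s)).toAdd
  have hFr : ∀ t t', F t' (FreeGroup.mk (List.ofFn (w t))) = 1 := by
    intro t t'
    fin_cases t'
    · change F₁ _ = 1
      simp [F₁, hr]
    · change F₂ _ = 1
      simp [F₂, hr]
  have hb := orth_bound (fun i => wordVec (w i)) (linInd_of_not_bad hp hw) u ?_ ?_
  · omega
  · rw [Fintype.linearIndependent_iff]
    intro c hc
    simp only [Fin.sum_univ_two] at hc
    have hF : ∀ x, F₁ x ^ c 0 * F₂ x ^ c 1 = 1 := by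
      intro x
      have : (zpowGroupHom (c 0)).comp F₁ * (zpowGroupHom (c 1)).comp F₂ = 1 := by
        ext s
        have := congrFun hc s
        simp only [Pi.add_apply, Pi.smul_apply, smul_eq_mul, Pi.zero_apply] at this
        simpa [u, F] using this
      exact DFunLike.congr_fun this x
    have b1 := hF x₁
    have b2 := hF x₂
    rw [a21, one_zpow, mul_one] at b1
    rw [a12, one_zpow, one_mul] at b2
    have aux : ∀ (y : Multiplicative ℤ) (a : ℤ), y ≠ 1 → y ^ a = 1 → a = 0 := by
      intro y a hy h
      have h' : a * y.toAdd = 0 := by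
        have := congrArg Multiplicative.toAdd h
        simpa using this
      rcases mul_eq_zero.1 h' with h' | h'
      · exact h'
      · exact absurd (toAdd_eq_zero.1 h') hy
    intro t
    fin_cases t
    · exact aux _ _ a11 b1
    · exact aux _ _ a22 b2
  · intro t t'
    have h3 := hom_word (F t') (w t)
    rw [hFr] at h3
    exact h3.symm

/-- The exponential sum attached to one letter. -/
noncomputable def expSum (p n : ℕ) [NeZero p] (a : ZMod p) (ψ : Fin n → ZMod p) : ℂ :=
  ∑ x : Fin n × Bool, ZMod.stdAddChar (a * ((letterSign x.2 : ZMod p) * ψ x.1))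

lemma norm_stdAddChar (p : ℕ) [NeZero p] (a : ZMod p) : ‖ZMod.stdAddChar a‖ = 1 := by
  rw [ZMod.stdAddChar_apply]
  exact Circle.norm_coe _

lemma expSum_eq (p n : ℕ) [NeZero p] (a : ZMod p) (ψ : Fin n → ZMod p) :
    expSum p n a ψ =
      ∑ s, (ZMod.stdAddChar (a * ψ s) + ZMod.stdAddChar (-(a * ψ s))) := by
  simp [expSum, Fintype.sum_prod_type, letterSign]

lemma pair_norm_le (p : ℕ) [NeZero p] (b : ZMod p) :
    ‖(ZMod.stdAddChar b + ZMod.stdAddChar (-b) : ℂ)‖ ≤ 2 := by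
  refine (norm_add_le _ _).trans ?_
  rw [norm_stdAddChar, norm_stdAddChar]; norm_num

lemma pair_norm_lt (p : ℕ) [Fact p.Prime] (hp2 : p ≠ 2) (b : ZMod p) (hb : b ≠ 0) :
    ‖(ZMod.stdAddChar b + ZMod.stdAddChar (-b) : ℂ)‖ < 2 := by
  have hne : (ZMod.stdAddChar b : ℂ) ≠ ZMod.stdAddChar (-b) := by
    intro h
    have h1 := ZMod.injective_stdAddChar h
    have h2 : (2 : ZMod p) * b = 0 := by
      rw [two_mul]; nth_rw 1 [h1]; simp
    rcases mul_eq_zero.1 h2 with h3 | h3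
    · have h4 : ((2 : ℕ) : ZMod p) = 0 := by exact_mod_cast h3
      rw [ZMod.natCast_eq_zero_iff] at h4
      exact hp2 ((Nat.prime_dvd_prime_iff_eq Fact.out Nat.prime_two).1 h4)
    · exact hb h3
  have := norm_add_lt_of_not_sameRay (x := (ZMod.stdAddChar b : ℂ))
    (y := ZMod.stdAddChar (-b)) (by
      intro h
      exact hne (h.eq_of_norm_eq (by rw [norm_stdAddChar, norm_stdAddChar])))
  rw [norm_stdAddChar, norm_stdAddChar] at this
  linarith

lemma expSum_norm_le (p n : ℕ) [NeZero p] (a : ZMod p) (ψ : Fin n → ZMod p) :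
    ‖expSum p n a ψ‖ ≤ 2 * n := by
  rw [expSum_eq]
  refine (norm_sum_le _ _).trans ?_
  refine (Finset.sum_le_sum fun s _ => pair_norm_le p (a * ψ s)).trans ?_
  simp [mul_comm]

lemma expSum_norm_lt (p n : ℕ) [Fact p.Prime] (hp2 : p ≠ 2) (a : ZMod p) (ha : a ≠ 0)
    (ψ : Fin n → ZMod p) (hψ : ψ ≠ 0) : ‖expSum p n a ψ‖ < 2 * n := by
  obtain ⟨s₀, hs₀⟩ := Function.ne_iff.1 hψ
  rw [expSum_eq]
  refine (norm_sum_le _ _).trans_lt ?_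
  refine (Finset.sum_lt_sum (g := fun _ => (2 : ℝ))
    (fun s _ => pair_norm_le p (a * ψ s)) ⟨s₀, Finset.mem_univ _,
      pair_norm_lt p hp2 _ (mul_ne_zero ha hs₀)⟩).trans_le ?_
  simp [mul_comm]

lemma stdAddChar_sum (p : ℕ) [NeZero p] {ι : Type*} [Fintype ι] (g : ι → ZMod p) :
    (ZMod.stdAddChar (∑ i, g i) : ℂ) = ∏ i, ZMod.stdAddChar (g i) := by
  have := map_prod (ZMod.stdAddChar (N := p)).toMonoidHom
    (fun i => Multiplicative.ofAdd (g i)) Finset.univ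
  rw [← ofAdd_sum] at this
  exact this

/-- Orthogonality of characters in `(ZMod p)^n`. -/
lemma char_orth (p n : ℕ) [NeZero p] (y : Fin n → ZMod p) :
    ∑ ψ : Fin n → ZMod p, (ZMod.stdAddChar (∑ s, ψ s * y s) : ℂ) =
      if y = 0 then (p : ℂ) ^ n else 0 := by
  have h1 : ∀ ψ : Fin n → ZMod p, (ZMod.stdAddChar (∑ s, ψ s * y s) : ℂ) =
      ∏ s, ZMod.stdAddChar (ψ s * y s) := fun ψ => stdAddChar_sum _ _
  simp only [h1]
  have h2 := Finset.prod_univ_sum (fun _ : Fin n => (Finset.univ : Finset (ZMod p)))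
    (fun s t => (ZMod.stdAddChar (t * y s) : ℂ))
  rw [Fintype.piFinset_univ] at h2
  rw [← h2]
  simp only [AddChar.sum_mulShift _ (ZMod.isPrimitive_stdAddChar p), ZMod.card]
  split_ifs with h
  · subst h; simp
  · obtain ⟨s, hs⟩ := Function.ne_iff.1 h
    exact Finset.prod_eq_zero (Finset.mem_univ s) (by simp [show y s ≠ 0 from hs])

open Classical in
lemma count_id (p n m ℓ : ℕ) [NeZero p] (c : Fin m → ZMod p) :
    (p : ℂ) ^ n * (Finset.univ.filter fun w : Fin m → Fin ℓ → Fin n × Bool =>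
        ∀ s, ∑ i, c i * (wordVec (w i) s : ZMod p) = 0).card =
      ∑ ψ : Fin n → ZMod p, ∏ i, expSum p n (c i) ψ ^ ℓ := by
  have h1 : ∀ ψ : Fin n → ZMod p, ∏ i, expSum p n (c i) ψ ^ ℓ =
      ∑ w : Fin m → Fin ℓ → Fin n × Bool,
        (ZMod.stdAddChar (∑ s, ψ s * ∑ i, c i * (wordVec (w i) s : ZMod p)) : ℂ) := by
    intro ψ
    simp only [expSum, Fintype.sum_pow]
    rw [Finset.prod_univ_sum, Fintype.piFinset_univ]
    refine Finset.sum_congr rfl fun w _ => ?_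
    simp only [← stdAddChar_sum]
    congr 1
    simp only [← Finset.mul_sum, ← sum_wordVec]
    simp only [Finset.mul_sum]
    rw [Finset.sum_comm]
    refine Finset.sum_congr rfl fun s _ => Finset.sum_congr rfl fun i _ => ?_
    ring
  simp only [h1]
  rw [Finset.sum_comm]
  simp only [char_orth p n]
  rw [← Finset.sum_filter, Finset.sum_const, nsmul_eq_mul, mul_comm]
  congr 3
  ext w
  simp [funext_iff]

/-- Normalized character value. -/
noncomputable def charVal (p n m : ℕ) [NeZero p] (c : Fin m → ZMod p) (ψ : Fin n → ZMod p) : ℝ :=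
  ∏ i, (‖expSum p n (c i) ψ‖ / (2 * n))

lemma charVal_nonneg (p n m : ℕ) [NeZero p] (c : Fin m → ZMod p) (ψ : Fin n → ZMod p) :
    0 ≤ charVal p n m c ψ := Finset.prod_nonneg fun _ _ => by positivity

lemma charVal_le_one (p n m : ℕ) [NeZero p] (hn : 1 ≤ n) (c : Fin m → ZMod p)
    (ψ : Fin n → ZMod p) : charVal p n m c ψ ≤ 1 := by
  have hn' : (0 : ℝ) < 2 * n := by positivity
  exact Finset.prod_le_one (fun _ _ => by positivity)
    fun i _ => (div_le_one hn').2 (expSum_norm_le p n _ _)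

lemma charVal_lt_one (p n m : ℕ) [Fact p.Prime] (hp2 : p ≠ 2) (hn : 1 ≤ n)
    (c : Fin m → ZMod p) (hc : c ≠ 0)
    (ψ : Fin n → ZMod p) (hψ : ψ ≠ 0) : charVal p n m c ψ < 1 := by
  have hn' : (0 : ℝ) < 2 * n := by positivity
  obtain ⟨i₀, hi₀⟩ := Function.ne_iff.1 hc
  rw [charVal, ← Finset.mul_prod_erase _ _ (Finset.mem_univ i₀)]
  have h1 : ‖expSum p n (c i₀) ψ‖ / (2 * n) < 1 :=
    (div_lt_one hn').2 (expSum_norm_lt p n hp2 _ hi₀ _ hψ)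
  have h2 : ∏ i ∈ Finset.univ.erase i₀, (‖expSum p n (c i) ψ‖ / (2 * n)) ≤ 1 :=
    Finset.prod_le_one (fun _ _ => by positivity)
      fun i _ => (div_le_one hn').2 (expSum_norm_le p n _ _)
  have h3 : 0 ≤ ‖expSum p n (c i₀) ψ‖ / (2 * n) := by positivity
  exact (mul_le_of_le_one_right h3 h2).trans_lt h1

open Classical in
lemma count_bound (p n m ℓ : ℕ) [NeZero p] (hn : 1 ≤ n) (c : Fin m → ZMod p) :
    ((Finset.univ.filter fun w : Fin m → Fin ℓ → Fin n × Bool =>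
        ∀ s, ∑ i, c i * (wordVec (w i) s : ZMod p) = 0).card : ℝ) /
        (Nat.card (Fin m → Fin ℓ → Fin n × Bool) : ℝ) ≤
      ((p : ℝ) ^ n)⁻¹ * ∑ ψ : Fin n → ZMod p, charVal p n m c ψ ^ ℓ := by
  have hp0 : (0 : ℝ) < p := by exact_mod_cast Nat.pos_of_ne_zero (NeZero.ne p)
  have hn' : (0 : ℝ) < 2 * n := by positivity
  have hcard : (Nat.card (Fin m → Fin ℓ → Fin n × Bool) : ℝ) = ((2 * n : ℝ) ^ ℓ) ^ m := by
    simp [mul_comm]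
  have h1 := congrArg norm (count_id p n m ℓ c)
  rw [norm_mul, norm_pow, Complex.norm_natCast, Complex.norm_natCast] at h1
  rw [hcard, div_le_iff₀ (by positivity), mul_assoc, ← div_eq_inv_mul,
    le_div_iff₀ (by positivity), mul_comm, h1, Finset.sum_mul]
  refine (norm_sum_le _ _).trans (Finset.sum_le_sum fun ψ _ => ?_)
  rw [norm_prod, charVal, ← Finset.prod_pow]
  apply le_of_eq
  have : ((2 * n : ℝ) ^ ℓ) ^ m = ∏ _i : Fin m, (2 * n : ℝ) ^ ℓ := by simp
  rw [this, ← Finset.prod_mul_distrib]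
  refine Finset.prod_congr rfl fun i _ => ?_
  rw [norm_pow, div_pow, div_mul_cancel₀ _ (by positivity)]

open Classical in
lemma bad_bound (p n m ℓ : ℕ) [NeZero p] (hn : 1 ≤ n) :
    ((Finset.univ.filter fun w : Fin m → Fin ℓ → Fin n × Bool => BadMod p w).card : ℝ) /
        (Nat.card (Fin m → Fin ℓ → Fin n × Bool) : ℝ) ≤
      ∑ c ∈ Finset.univ.filter (fun c : Fin m → ZMod p => c ≠ 0),
        ((p : ℝ) ^ n)⁻¹ * ∑ ψ : Fin n → ZMod p, charVal p n m c ψ ^ ℓ := by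
  refine le_trans ?_ (Finset.sum_le_sum fun c _ => count_bound p n m ℓ hn c)
  rw [← Finset.sum_div]
  gcongr
  norm_cast
  refine le_trans (Finset.card_le_card ?_) Finset.card_biUnion_le
  intro w hw
  obtain ⟨c, hc, h⟩ := (Finset.mem_filter.1 hw).2
  simp only [Finset.mem_biUnion, Finset.mem_filter, Finset.mem_univ, true_and]
  exact ⟨c, hc, h⟩

open Classical in
lemma bound_tendsto (p n m : ℕ) [Fact p.Prime] (hp2 : p ≠ 2) (hn : 1 ≤ n) :
    Filter.Tendsto (fun ℓ : ℕ => ∑ c ∈ Finset.univ.filter (fun c : Fin m → ZMod p => c ≠ 0),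
        ((p : ℝ) ^ n)⁻¹ * ∑ ψ : Fin n → ZMod p, charVal p n m c ψ ^ ℓ) Filter.atTop
      (nhds (∑ c ∈ Finset.univ.filter (fun c : Fin m → ZMod p => c ≠ 0),
        ((p : ℝ) ^ n)⁻¹ * ∑ ψ : Fin n → ZMod p, if ψ = 0 then 1 else 0)) := by
  refine tendsto_finsetSum _ fun c hc => ?_
  refine Filter.Tendsto.const_mul _ (tendsto_finsetSum _ fun ψ _ => ?_)
  split_ifs with h
  · have h1 : charVal p n m c ψ = 1 := by
      have hn' : (n : ℝ) ≠ 0 := by positivity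
      refine Finset.prod_eq_one fun i _ => ?_
      rw [expSum_eq, h]
      simp only [Pi.zero_apply, mul_zero, neg_zero, AddChar.map_zero_eq_one, Finset.sum_const,
        Finset.card_univ, Fintype.card_fin, nsmul_eq_mul]
      rw [norm_mul, Complex.norm_natCast]
      norm_num
      field_simp
    have h2 : (fun ℓ : ℕ => charVal p n m c ψ ^ ℓ) = fun _ => (1 : ℝ) := by
      funext ℓ; rw [h1, one_pow]
    change Filter.Tendsto (fun ℓ : ℕ => charVal p n m c ψ ^ ℓ) _ _
    rw [h2]
    exact tendsto_const_nhds
  · exact tendsto_pow_atTop_nhds_zero_of_lt_one (charVal_nonneg _ _ _ _ _)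
      (charVal_lt_one p n m hp2 hn c (Finset.mem_filter.1 hc).2 ψ h)

open Classical in
lemma bad_eventually (p n m : ℕ) (hp : p.Prime) (hp2 : p ≠ 2) (hnm : m + 1 ≤ n) :
    ∀ᶠ ℓ : ℕ in Filter.atTop,
      ((Finset.univ.filter fun w : Fin m → Fin ℓ → Fin n × Bool => BadMod p w).card : ℝ) /
        (Nat.card (Fin m → Fin ℓ → Fin n × Bool) : ℝ) < 2 / p := by
  have : Fact p.Prime := ⟨hp⟩
  have hp0 : (0 : ℝ) < p := by exact_mod_cast hp.pos
  have hp1 : (1 : ℝ) ≤ p := by exact_mod_cast hp.one_lt.le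
  have hlim : (∑ c ∈ Finset.univ.filter (fun c : Fin m → ZMod p => c ≠ 0),
        ((p : ℝ) ^ n)⁻¹ * ∑ ψ : Fin n → ZMod p, if ψ = 0 then (1 : ℝ) else 0) < 2 / p := by
    simp only [Finset.sum_ite_eq', Finset.mem_univ, if_true, mul_one, Finset.sum_const,
      nsmul_eq_mul]
    have hc : ((Finset.univ.filter (fun c : Fin m → ZMod p => c ≠ 0)).card : ℝ) ≤ (p : ℝ) ^ m := by
      have := Finset.card_filter_le (Finset.univ : Finset (Fin m → ZMod p)) (fun c => c ≠ 0)
      rw [Finset.card_univ, Fintype.card_fun, ZMod.card, Fintype.card_fin] at this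
      exact_mod_cast this
    rw [← div_eq_mul_inv, div_lt_div_iff₀ (by positivity) hp0]
    have h2 : (p : ℝ) ^ m * p ≤ (p : ℝ) ^ n := by
      rw [← pow_succ]; exact pow_le_pow_right₀ hp1 hnm
    have h3 : (0 : ℝ) < (p : ℝ) ^ n := by positivity
    nlinarith
  filter_upwards [(bound_tendsto p n m hp2 (by omega)).eventually (gt_mem_nhds hlim)] with ℓ hℓ
  exact (bad_bound p n m ℓ (by omega)).trans_lt hℓ

/-- If `n ≥ m + 1`, then asymptotically almost surely as `ℓ → ∞`, in any
direct decomposition of a random `m`-relator metabelian group on `n` generators all but at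
most one factor is virtually abelian. -/
theorem random_metabelian_direct_decomposition {n m : ℕ} (hn : 1 ≤ n) (hm : 1 ≤ m)
    (hnm : m + 1 ≤ n) :
    Filter.Tendsto (fun ℓ : ℕ =>
      (Nat.card {w : Fin m → Fin ℓ → Fin n × Bool //
          ∀ (k : ℕ) (Gi : Fin k → Type) [∀ i, Group (Gi i)],
            (RandomMetabelian w ≃* ∀ i, Gi i) →
            ∀ i j : Fin k, i ≠ j →
              VirtuallyAbelian (Gi i) ∨ VirtuallyAbelian (Gi j)} : ℝ) /
        (Nat.card (Fin m → Fin ℓ → Fin n × Bool) : ℝ))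
      Filter.atTop (nhds 1) := by
  classical
  rw [Metric.tendsto_nhds]
  intro ε hε
  obtain ⟨p, hpN, hp⟩ := Nat.exists_infinite_primes (max 3 (⌈2 / ε⌉₊ + 1))
  have hp3 : 3 ≤ p := (le_max_left _ _).trans hpN
  have hp0 : (0 : ℝ) < p := by exact_mod_cast hp.pos
  have hpε : 2 / (p : ℝ) < ε := by
    have h1 : ⌈2 / ε⌉₊ + 1 ≤ p := (le_max_right _ _).trans hpN
    have h2 : (⌈2 / ε⌉₊ : ℝ) + 1 ≤ p := by exact_mod_cast h1
    have h3 := Nat.le_ceil (2 / ε)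
    rw [div_lt_comm₀ hp0 hε]
    linarith
  filter_upwards [bad_eventually p n m hp (by omega) hnm] with ℓ hℓ
  have hT : (0 : ℝ) < (Nat.card (Fin m → Fin ℓ → Fin n × Bool) : ℝ) := by
    have : Nonempty (Fin n × Bool) := ⟨(⟨0, hn⟩, true)⟩
    exact_mod_cast Nat.card_pos
  generalize hP : (fun w : Fin m → Fin ℓ → Fin n × Bool =>
    ∀ (k : ℕ) (Gi : Fin k → Type) [∀ i, Group (Gi i)],
            (RandomMetabelian w ≃* ∀ i, Gi i) →
            ∀ i j : Fin k, i ≠ j →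
              VirtuallyAbelian (Gi i) ∨ VirtuallyAbelian (Gi j)) = P
  have hgood : ∀ w, ¬ BadMod p w → P w := by
    intro w hw
    rw [← hP]
    intro k Gi _ e i j hij
    by_cases h : m + 2 ≤ n
    · exact core_one h _ k Gi e i j hij
    · exact core_two hp (by omega) hw k Gi e i j hij
  have hcard : (Nat.card {w // P w} : ℝ) ≤ (Nat.card (Fin m → Fin ℓ → Fin n × Bool) : ℝ) := by
    exact_mod_cast Nat.card_le_card_of_injective _ Subtype.val_injective
  have hcard2 : (Nat.card (Fin m → Fin ℓ → Fin n × Bool) : ℝ) ≤ Nat.card {w // P w} +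
      ((Finset.univ.filter fun w : Fin m → Fin ℓ → Fin n × Bool => BadMod p w).card : ℝ) := by
    rw [Nat.card_eq_fintype_card, Nat.card_eq_fintype_card, Fintype.card_subtype]
    norm_cast
    rw [← Finset.card_univ]
    refine le_trans (Finset.card_le_card ?_) (Finset.card_union_le _ _)
    intro w _
    by_cases hb : BadMod p w
    · exact Finset.mem_union_right _ (by simpa using hb)
    · exact Finset.mem_union_left _ (by simpa using hgood w hb)
  rw [Real.dist_eq, abs_sub_comm, abs_of_nonneg (by
    rw [sub_nonneg]; exact (div_le_one hT).2 hcard)]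
  refine lt_of_le_of_lt ?_ (hℓ.trans hpε)
  rw [sub_le_iff_le_add, ← add_div, le_div_iff₀ hT, one_mul]
  linarith
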